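/- arXiv:1701.07579 — 2 statements merged into one kernel-verified Lean document; each statement's English description precedes it below -/
import Mathlib

section
/- Let k ≥ 4, r = 2, and t ∈ {3, 4}. Then k + t − 2 + ⌈((t−1)(k−1)+1)/t⌉ ≤ B(k,2,t) ≤ k + ⌈(t−1)·k/2⌉. -/
/-- `R` is a recovery set for information coordinate `i` of the linear encoding `C`. -/
def IsRecoverySet {F : Type} [Field F] {k : ℕ} {ι : Type}
    (C : (Fin k → F) →ₗ[F] (ι → F)) (i : Fin k) (R : Finset ι) : Prop :=
  ∀ x x' : Fin k → F, (∀ j ∈ R, C x j = C x' j) → x i = x' i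

/-- `C` is an `(n,k,r,t)` batch code: every query of `t` (possibly repeated) information
coordinates is served by `t` pairwise disjoint recovery sets, each of size at most `r`. -/
def IsBatchCode {F : Type} [Field F] {k : ℕ} {ι : Type} (r t : ℕ)
    (C : (Fin k → F) →ₗ[F] (ι → F)) : Prop :=
  Function.Injective C ∧
    ∀ q : Fin t → Fin k, ∃ R : Fin t → Finset ι,
      (∀ l₁ l₂ : Fin t, l₁ ≠ l₂ → Disjoint (R l₁) (R l₂)) ∧
      (∀ l : Fin t, (R l).card ≤ r) ∧
      (∀ l : Fin t, IsRecoverySet C (q l) (R l))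

/-- `C` is an `(n,k,r,t)` PIR code: every query `(x_i, …, x_i)` of size `t` is served by
`t` pairwise disjoint recovery sets for `i`, each of size at most `r`. -/
def IsPIRCode {F : Type} [Field F] {k : ℕ} {ι : Type} (r t : ℕ)
    (C : (Fin k → F) →ₗ[F] (ι → F)) : Prop :=
  Function.Injective C ∧
    ∀ i : Fin k, ∃ R : Fin t → Finset ι,
      (∀ l₁ l₂ : Fin t, l₁ ≠ l₂ → Disjoint (R l₁) (R l₂)) ∧
      (∀ l : Fin t, (R l).card ≤ r) ∧
      (∀ l : Fin t, IsRecoverySet C i (R l))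

/-- `C` is systematic: the information vector appears in the first `k` coordinates. -/
def IsSystematic {F : Type} [Field F] {k n : ℕ}
    (C : (Fin k → F) →ₗ[F] (Fin n → F)) : Prop :=
  ∀ x : Fin k → F, ∀ i : Fin k, ∃ h : (i : ℕ) < n, C x ⟨i, h⟩ = x i


section Shortening

variable {F : Type} [Field F] {k : ℕ} {ι : Type}

/-- The information vectors whose codewords vanish on all coordinates in `N`. -/
def shortening (C : (Fin k → F) →ₗ[F] (ι → F)) (N : Finset ι) : Submodule F (Fin k → F) where
  carrier := {x | ∀ j ∈ N, C x j = 0}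
  add_mem' {x y} hx hy j hj := by simp [hx j hj, hy j hj]
  zero_mem' j _ := by simp
  smul_mem' c x hx j hj := by simp [hx j hj]

lemma mem_shortening {C : (Fin k → F) →ₗ[F] (ι → F)} {N : Finset ι} {x : Fin k → F} :
    x ∈ shortening C N ↔ ∀ j ∈ N, C x j = 0 := Iff.rfl

lemma shortening_anti (C : (Fin k → F) →ₗ[F] (ι → F)) {M N : Finset ι} (h : M ⊆ N) :
    shortening C N ≤ shortening C M := fun _ hx j hj => hx j (h hj)

lemma finrank_shortening_empty (C : (Fin k → F) →ₗ[F] (ι → F)) :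
    Module.finrank F (shortening C ∅) = k := by
  have : shortening C ∅ = ⊤ := by
    ext x
    simp [mem_shortening]
  rw [this, finrank_top, Module.finrank_fin_fun]

lemma finrank_le_finrank_inf_ker_add_one (V : Submodule F (Fin k → F))
    (f : (Fin k → F) →ₗ[F] F) :
    Module.finrank F V ≤ Module.finrank F (V ⊓ LinearMap.ker f : Submodule F (Fin k → F)) + 1 := by
  have h₁ := Submodule.finrank_sup_add_finrank_inf_eq V (LinearMap.ker f)
  have h₂ := LinearMap.finrank_range_add_finrank_ker f
  have h₃ := Submodule.finrank_le (V ⊔ LinearMap.ker f)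
  have h₄ := Submodule.finrank_le (LinearMap.range f)
  rw [Module.finrank_self] at h₄
  omega

lemma IsRecoverySet.exists_coeff {C : (Fin k → F) →ₗ[F] (ι → F)} {i : Fin k} {R : Finset ι}
    (h : IsRecoverySet C i R) : ∃ c : ι → F, ∀ x, x i = ∑ j ∈ R, c j * C x j := by
  have hmem : (LinearMap.proj i : (Fin k → F) →ₗ[F] F) ∈
      Submodule.span F (Set.range fun j : R => (LinearMap.proj (j : ι)).comp C) := by
    apply mem_span_of_iInf_ker_le_ker
    intro x hx
    simp only [Submodule.mem_iInf, LinearMap.mem_ker, LinearMap.comp_apply,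
      LinearMap.proj_apply, Subtype.forall] at hx ⊢
    simpa using h x 0 (by simpa using hx)
  obtain ⟨c, hc⟩ := (Submodule.mem_span_range_iff_exists_fun F).1 hmem
  classical
  refine ⟨fun j => if hj : j ∈ R then c ⟨j, hj⟩ else 0, fun x => ?_⟩
  have hx := congrArg (fun f => f x) hc
  simp only [LinearMap.proj_apply, LinearMap.sum_apply, LinearMap.smul_apply,
    LinearMap.comp_apply, smul_eq_mul] at hx
  rw [← hx, ← Finset.sum_coe_sort R]
  exact Finset.sum_congr rfl fun j _ => by simp

lemma IsBatchCode.isPIRCode {C : (Fin k → F) →ₗ[F] (ι → F)} {r t : ℕ}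
    (hC : IsBatchCode r t C) : IsPIRCode r t C :=
  ⟨hC.1, fun i => hC.2 fun _ => i⟩

variable [DecidableEq ι]

lemma finrank_shortening_le_insert (C : (Fin k → F) →ₗ[F] (ι → F)) (N : Finset ι) (a : ι) :
    Module.finrank F (shortening C N) ≤ Module.finrank F (shortening C (insert a N)) + 1 := by
  have : shortening C (insert a N) =
      shortening C N ⊓ LinearMap.ker ((LinearMap.proj a).comp C) := by
    ext x
    simp [mem_shortening, and_comm]
  rw [this]
  exact finrank_le_finrank_inf_ker_add_one _ _

lemma finrank_shortening_le_union (C : (Fin k → F) →ₗ[F] (ι → F)) (N S : Finset ι) :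
    Module.finrank F (shortening C N) ≤ Module.finrank F (shortening C (N ∪ S)) + S.card := by
  induction S using Finset.induction_on with
  | empty => rw [Finset.union_empty, Finset.card_empty, add_zero]
  | insert a S ha ih =>
    have := finrank_shortening_le_insert C (N ∪ S) a
    rw [Finset.union_insert, Finset.card_insert_of_notMem ha]
    omega

lemma card_add_finrank_shortening_le_union (C : (Fin k → F) →ₗ[F] (ι → F)) (N S : Finset ι) :
    N.card + Module.finrank F (shortening C N) ≤
      (N ∪ S).card + Module.finrank F (shortening C (N ∪ S)) := by
  have h := finrank_shortening_le_union C N (S \ N)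
  rw [Finset.union_sdiff_self_eq_union] at h
  have := Finset.card_union_of_disjoint (Finset.disjoint_sdiff (s := N) (t := S))
  rw [Finset.union_sdiff_self_eq_union] at this
  omega

/-- Adjoining a recovery set of size at most two to a coordinate set `M` that already determines
the recovered symbol costs at most one dimension and gains one unit of redundancy. -/
lemma exists_adjoin_recoverySet {C : (Fin k → F) →ₗ[F] (ι → F)} {i : Fin k} {R N M : Finset ι}
    (hR : IsRecoverySet C i R) (hcard : R.card ≤ 2) (hN : ∃ x ∈ shortening C N, x i ≠ 0)
    (hM : ∀ x ∈ shortening C M, x i = 0) (hRM : ∀ j ∈ R, j ∈ M → j ∈ N) :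
    Module.finrank F (shortening C M) ≤ Module.finrank F (shortening C (M ∪ R)) + 1 ∧
      M.card + Module.finrank F (shortening C M) + 1 ≤
        (M ∪ R).card + Module.finrank F (shortening C (M ∪ R)) := by
  obtain ⟨c, hc⟩ := hR.exists_coeff
  obtain ⟨x, hx, hxi⟩ := hN
  obtain ⟨a, haR, ha⟩ : ∃ a ∈ R, c a * C x a ≠ 0 := by
    apply Finset.exists_ne_zero_of_sum_ne_zero
    rwa [← hc x]
  have haN : a ∉ N := fun h => ha (by simp [hx a h])
  have haM : a ∉ M ∪ R.erase a := by
    simpa using fun h => haN (hRM a haR h)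
  have hunion : insert a (M ∪ R.erase a) = M ∪ R := by
    rw [← Finset.union_insert, Finset.insert_erase haR]
  have hsame : shortening C (M ∪ R) = shortening C (M ∪ R.erase a) := by
    refine le_antisymm (shortening_anti C (hunion ▸ Finset.subset_insert _ _)) fun y hy => ?_
    rw [← hunion]
    intro j hj
    rcases Finset.mem_insert.1 hj with rfl | hj
    · have h₀ := hM y (shortening_anti C Finset.subset_union_left hy)
      rw [hc y, ← Finset.add_sum_erase R _ haR, Finset.sum_eq_zero, add_zero] at h₀
      · exact (mul_eq_zero.1 h₀).resolve_left (left_ne_zero_of_mul ha)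
      · intro l hl
        rw [hy l (Finset.mem_union_right _ hl), mul_zero]
    · exact hy j hj
  have h₁ := finrank_shortening_le_union C M (R.erase a)
  have h₂ := card_add_finrank_shortening_le_union C M (R.erase a)
  have h₃ := Finset.card_insert_of_notMem haM
  have h₄ := Finset.card_erase_of_mem haR
  rw [hunion] at h₃
  rw [hsame]
  omega

/-- Greedy adjunction of the disjoint recovery sets `R l`, `l ∈ s`, of a symbol not determined
by `N`, stopping early if the dimension would drop to zero. -/
lemma exists_adjoin_disjoint_recoverySets {C : (Fin k → F) →ₗ[F] (ι → F)} {i : Fin k} {i₀ : ι}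
    (hi₀ : ∀ x, C x i₀ = x i) {t : ℕ} {R : Fin t → Finset ι}
    (hdisj : ∀ l₁ l₂ : Fin t, l₁ ≠ l₂ → Disjoint (R l₁) (R l₂))
    (hcard : ∀ l, (R l).card ≤ 2) (hR : ∀ l, IsRecoverySet C i (R l)) {N : Finset ι}
    (hN : ∃ x ∈ shortening C N, x i ≠ 0) (hd : 2 ≤ Module.finrank F (shortening C N))
    (s : Finset (Fin t)) (hs : ∀ l ∈ s, i₀ ∉ R l) :
    (∃ M, Module.finrank F (shortening C M) = 1 ∧
      N.card + 2 * Module.finrank F (shortening C N) ≤ M.card + 3) ∨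
    1 ≤ Module.finrank F (shortening C (insert i₀ N ∪ s.biUnion R)) ∧
      Module.finrank F (shortening C (insert i₀ N ∪ s.biUnion R)) <
        Module.finrank F (shortening C N) ∧
      Module.finrank F (shortening C N) ≤
        Module.finrank F (shortening C (insert i₀ N ∪ s.biUnion R)) + 1 + s.card ∧
      N.card + Module.finrank F (shortening C N) + s.card ≤ (insert i₀ N ∪ s.biUnion R).card +
        Module.finrank F (shortening C (insert i₀ N ∪ s.biUnion R)) := by
  induction s using Finset.induction_on with
  | empty =>
    right
    have h₁ := finrank_shortening_le_insert C N i₀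
    have h₂ := card_add_finrank_shortening_le_union C N {i₀}
    rw [Finset.union_comm, ← Finset.insert_eq] at h₂
    have h₃ : Module.finrank F (shortening C (insert i₀ N)) <
        Module.finrank F (shortening C N) := by
      apply Submodule.finrank_lt_finrank_of_lt
      refine lt_of_le_of_ne (shortening_anti C (Finset.subset_insert _ _)) fun h => ?_
      obtain ⟨x, hx, hxi⟩ := hN
      rw [← h] at hx
      exact hxi (by rw [← hi₀ x]; exact hx i₀ (Finset.mem_insert_self _ _))
    rw [Finset.biUnion_empty, Finset.union_empty, Finset.card_empty]
    omega
  | insert l s hl ih =>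
    rcases ih fun l' hl' => hs l' (Finset.mem_insert_of_mem hl') with h | ⟨h₁, h₂, h₃, h₄⟩
    · exact Or.inl h
    have key := exists_adjoin_recoverySet (M := insert i₀ N ∪ s.biUnion R) (hR l) (hcard l) hN
      (fun x hx => by rw [← hi₀ x]; exact hx i₀ (by simp)) (by
        intro j hj hjM
        simp only [Finset.mem_union, Finset.mem_insert, Finset.mem_biUnion] at hjM
        rcases hjM with (rfl | hjN) | ⟨l', hl', hjl'⟩
        · exact absurd hj (hs l (Finset.mem_insert_self _ _))
        · exact hjN
        · have hne : l ≠ l' := fun h => hl (h ▸ hl')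
          exact absurd hjl' (Finset.disjoint_left.1 (hdisj l l' hne) hj))
    have hunion : insert i₀ N ∪ (insert l s).biUnion R = insert i₀ N ∪ s.biUnion R ∪ R l := by
      rw [Finset.biUnion_insert, Finset.union_comm (R l), Finset.union_assoc]
    have hle := Submodule.finrank_mono (shortening_anti C
      (Finset.subset_union_left (s₁ := insert i₀ N ∪ s.biUnion R) (s₂ := R l)))
    rw [hunion, Finset.card_insert_of_notMem hl]
    by_cases h₀ : Module.finrank F (shortening C (insert i₀ N ∪ s.biUnion R ∪ R l)) = 0
    · exact Or.inl ⟨insert i₀ N ∪ s.biUnion R, by omega, by omega⟩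
    · right
      omega

/-- In a systematic code with availability, coordinate sets can be enlarged to sets of corank one
with large redundancy. -/
lemma exists_finrank_shortening_eq_one {C : (Fin k → F) →ₗ[F] (ι → F)} {σ : Fin k → ι}
    (hσ : ∀ x i, C x (σ i) = x i) {T : ℕ} (hC : IsPIRCode 2 (T + 1) C) (d : ℕ) (hd : 1 ≤ d)
    (N : Finset ι) (hN : Module.finrank F (shortening C N) = d) :
    ∃ M, Module.finrank F (shortening C M) = 1 ∧
      (T + 1) * (N.card + d) + T * d ≤ (T + 1) * (M.card + 1) + 2 * T := by
  induction d using Nat.strong_induction_on generalizing N with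
  | _ d ih =>
    rcases hd.eq_or_lt with rfl | hd
    · exact ⟨N, hN, by omega⟩
    obtain ⟨x, hx, hx₀⟩ := (shortening C N).ne_bot_iff.1 (by
      intro h
      rw [h, finrank_bot] at hN
      omega)
    obtain ⟨i, hi⟩ := Function.ne_iff.1 hx₀
    obtain ⟨R, hdisj, hcard, hR⟩ := hC.2 i
    have hone : (Finset.univ.filter fun l => σ i ∈ R l).card ≤ 1 := by
      refine Finset.card_le_one.2 fun l hl l' hl' => ?_
      by_contra hne
      exact Finset.disjoint_left.1 (hdisj l l' hne) (Finset.mem_filter.1 hl).2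
        (Finset.mem_filter.1 hl').2
    have hsum := Finset.card_filter_add_card_filter_not
      (s := (Finset.univ : Finset (Fin (T + 1)))) (fun l => σ i ∈ R l)
    rw [Finset.card_univ, Fintype.card_fin] at hsum
    obtain ⟨s, hs, hsT⟩ := Finset.exists_subset_card_eq
      (show T ≤ (Finset.univ.filter fun l => ¬ σ i ∈ R l).card by omega)
    rcases exists_adjoin_disjoint_recoverySets (hσ · i) hdisj hcard hR ⟨x, hx, hi⟩ (by omega) s
      (fun l hl => (Finset.mem_filter.1 (hs hl)).2) with ⟨M, hM, hNM⟩ | ⟨h₁, h₂, h₃, h₄⟩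
    · refine ⟨M, hM, ?_⟩
      rw [hN] at hNM
      nlinarith [Nat.mul_le_mul_left T hNM]
    · rw [hN] at h₂ h₃ h₄
      obtain ⟨M, hM, hle⟩ := ih _ h₂ h₁ _ rfl
      refine ⟨M, hM, ?_⟩
      rw [hsT] at h₃ h₄
      nlinarith [Nat.mul_le_mul_left T h₃, Nat.mul_le_mul_left (T + 1) h₄]

lemma IsPIRCode.card_add_le_of_shortening_ne_bot [Fintype ι] {C : (Fin k → F) →ₗ[F] (ι → F)}
    {r t : ℕ} (hC : IsPIRCode r t C) {M : Finset ι} (hM : shortening C M ≠ ⊥) :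
    M.card + t ≤ Fintype.card ι := by
  obtain ⟨x, hx, hx₀⟩ := (shortening C M).ne_bot_iff.1 hM
  obtain ⟨i, hi⟩ := Function.ne_iff.1 hx₀
  obtain ⟨R, hdisj, -, hR⟩ := hC.2 i
  have hex : ∀ l, ∃ j ∈ R l, C x j ≠ 0 := by
    intro l
    by_contra! h
    exact hi (by simpa using hR l x 0 (by simpa using h))
  choose j hj hj₀ using hex
  have hinj : Function.Injective j := by
    intro l l' h
    by_contra hne
    exact Finset.disjoint_left.1 (hdisj l l' hne) (hj l) (h ▸ hj l')
  have hd : Disjoint M (Finset.univ.image j) := by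
    rw [Finset.disjoint_right]
    intro a ha haM
    obtain ⟨l, -, rfl⟩ := Finset.mem_image.1 ha
    exact hj₀ l (hx _ haM)
  have := Finset.card_le_univ (M ∪ Finset.univ.image j)
  rwa [Finset.card_union_of_disjoint hd, Finset.card_image_of_injective _ hinj,
    Finset.card_univ, Fintype.card_fin] at this

lemma IsPIRCode.length_lower_bound {n T : ℕ} {C : (Fin k → F) →ₗ[F] (Fin n → F)}
    (hs : IsSystematic C) (hC : IsPIRCode 2 (T + 1) C) (hk : 1 ≤ k) :
    (2 * T + 1) * k + T * T ≤ (T + 1) * n + T := by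
  obtain ⟨M, hM, hle⟩ := exists_finrank_shortening_eq_one
    (σ := fun i => ⟨i, (hs 0 i).1⟩) (fun x i => (hs x i).2) hC k hk ∅
    (finrank_shortening_empty C)
  have hcard := hC.card_add_le_of_shortening_ne_bot (M := M) (by
    intro h
    rw [h, finrank_bot] at hM
    omega)
  rw [Fintype.card_fin] at hcard
  rw [Finset.card_empty] at hle
  nlinarith [Nat.mul_le_mul_left (T + 1) hcard]

end Shortening

section GraphCode

variable {k m : ℕ}

/-- The systematic code whose parity symbols are the sums over the edges `{u e, v e}`. -/
def graphCode (u v : Fin m → Fin k) :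
    (Fin k → ZMod 2) →ₗ[ZMod 2] (Fin (k + m) → ZMod 2) where
  toFun x := Fin.append x fun e => x (u e) + x (v e)
  map_add' x y := by
    ext j
    refine Fin.addCases (fun a => ?_) (fun e => ?_) j
    · simp
    · simp only [Fin.append_right, Pi.add_apply]
      ring
  map_smul' c x := by
    ext j
    refine Fin.addCases (fun a => ?_) (fun e => ?_) j
    · simp
    · simp only [Fin.append_right, Pi.smul_apply, smul_eq_mul, RingHom.id_apply]
      ring

@[simp]
lemma graphCode_castAdd (u v : Fin m → Fin k) (x : Fin k → ZMod 2) (a : Fin k) :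
    graphCode u v x (Fin.castAdd m a) = x a :=
  Fin.append_left x (fun e => x (u e) + x (v e)) a

@[simp]
lemma graphCode_natAdd (u v : Fin m → Fin k) (x : Fin k → ZMod 2) (e : Fin m) :
    graphCode u v x (Fin.natAdd k e) = x (u e) + x (v e) :=
  Fin.append_right x (fun e => x (u e) + x (v e)) e

lemma isSystematic_graphCode (u v : Fin m → Fin k) : IsSystematic (graphCode u v) :=
  fun x i => ⟨by omega, graphCode_castAdd u v x i⟩

/-- The edge `e` joins the vertices `a` and `w`. -/
def Joins (u v : Fin m → Fin k) (e : Fin m) (a w : Fin k) : Prop :=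
  u e = a ∧ v e = w ∨ u e = w ∧ v e = a

lemma Joins.isRecoverySet {u v : Fin m → Fin k} {e : Fin m} {a w : Fin k}
    (h : Joins u v e a w) :
    IsRecoverySet (graphCode u v) a {Fin.castAdd m w, Fin.natAdd k e} := by
  intro x x' hx
  have h₁ := hx (Fin.castAdd m w) (by simp)
  have h₂ := hx (Fin.natAdd k e) (by simp)
  simp only [graphCode_castAdd, graphCode_natAdd] at h₁ h₂
  rcases h with ⟨rfl, rfl⟩ | ⟨rfl, rfl⟩
  · simpa [h₁] using h₂
  · simpa [h₁] using h₂

/-- Greedy choice of distinct neighbours avoiding the queried vertices. -/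
lemma exists_injOn_neighbours {u v : Fin m → Fin k} {t : ℕ}
    (hdeg : ∀ a, ∃ W : Finset (Fin k), t ≤ W.card + 1 ∧ ∀ w ∈ W, w ≠ a ∧ ∃ e, Joins u v e a w)
    (q : Fin t → Fin k) (S : Finset (Fin t)) (hS : S.card + (Finset.univ.image q).card ≤ t) :
    ∃ w : Fin t → Fin k, Set.InjOn w S ∧
      ∀ l ∈ S, w l ∉ Finset.univ.image q ∧ ∃ e, Joins u v e (q l) (w l) := by
  induction S using Finset.induction_on with
  | empty => exact ⟨q, by simp, by simp⟩
  | insert l S hl ih =>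
    rw [Finset.card_insert_of_notMem hl] at hS
    obtain ⟨w, hinj, hw⟩ := ih (by omega)
    obtain ⟨W, hW, hadj⟩ := hdeg (q l)
    have hB : ((Finset.univ.image q).erase (q l) ∪ S.image w).card < W.card := by
      have h₁ := Finset.card_union_le ((Finset.univ.image q).erase (q l)) (S.image w)
      have h₂ : (S.image w).card ≤ S.card := Finset.card_image_le
      have hq : q l ∈ Finset.univ.image q := Finset.mem_image_of_mem q (Finset.mem_univ l)
      have h₃ := Finset.card_erase_of_mem hq
      have h₄ := Finset.card_pos.2 ⟨_, hq⟩
      omega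
    obtain ⟨b, hbW, hb⟩ := Finset.exists_mem_notMem_of_card_lt_card hB
    rw [Finset.mem_union, not_or, Finset.mem_erase, not_and] at hb
    have hne : ∀ l' ∈ S, l' ≠ l := fun l' hl' h => hl (h ▸ hl')
    refine ⟨Function.update w l b, ?_, fun l' hl' => ?_⟩
    · rw [Finset.coe_insert, Set.injOn_insert (by simpa using hl)]
      refine ⟨fun x hx y hy hxy => hinj hx hy ?_, ?_⟩
      · rwa [Function.update_of_ne (hne x hx), Function.update_of_ne (hne y hy)] at hxy
      · rintro ⟨l', hl', h⟩
        rw [Function.update_of_ne (hne l' hl'), Function.update_self] at h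
        exact hb.2 (Finset.mem_image.2 ⟨l', hl', h⟩)
    · rcases Finset.mem_insert.1 hl' with rfl | hl'
      · rw [Function.update_self]
        exact ⟨hb.1 (hadj b hbW).1, (hadj b hbW).2⟩
      · rw [Function.update_of_ne (hne l' hl')]
        exact hw l' hl'

/-- The code of a graph of minimum degree at least `t - 1` is a `t`-batch code with `r = 2`. -/
lemma isBatchCode_graphCode {u v : Fin m → Fin k} {t : ℕ}
    (hdeg : ∀ a, ∃ W : Finset (Fin k), t ≤ W.card + 1 ∧
      ∀ w ∈ W, w ≠ a ∧ ∃ e, Joins u v e a w) : IsBatchCode 2 t (graphCode u v) := by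
  refine ⟨fun x y h => ?_, fun q => ?_⟩
  · ext a
    simpa using congrFun h (Fin.castAdd m a)
  obtain ⟨A', hA', hAinj⟩ := Set.exists_image_eq_and_injOn Set.univ q
  obtain ⟨A, rfl⟩ := A'.toFinite.exists_finset_coe
  have hA : A.image q = Finset.univ.image q := by
    rw [← Finset.coe_inj]
    simpa using hA'
  have hcard : Aᶜ.card + (Finset.univ.image q).card ≤ t := by
    rw [← hA, Finset.card_image_of_injOn hAinj, Finset.card_compl_add_card, Fintype.card_fin]
  obtain ⟨w, hinj, hw⟩ := exists_injOn_neighbours hdeg q Aᶜ hcard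
  have hex : ∀ l, ∃ R : Finset (Fin (k + m)), (l ∈ A ∧ R = {Fin.castAdd m (q l)}) ∨
      (l ∈ Aᶜ ∧ ∃ e, Joins u v e (q l) (w l) ∧ R = {Fin.castAdd m (w l), Fin.natAdd k e}) := by
    intro l
    by_cases hl : l ∈ A
    · exact ⟨_, Or.inl ⟨hl, rfl⟩⟩
    · obtain ⟨e, he⟩ := (hw l (Finset.mem_compl.2 hl)).2
      exact ⟨_, Or.inr ⟨Finset.mem_compl.2 hl, e, he, rfl⟩⟩
  choose R hR using hex
  have hwq : ∀ l ∈ Aᶜ, ∀ l', w l ≠ q l' := fun l hl l' h =>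
    (hw l hl).1 (h ▸ Finset.mem_image_of_mem q (Finset.mem_univ l'))
  refine ⟨R, fun l l' hne => ?_, fun l => ?_, fun l => ?_⟩
  · rcases hR l with ⟨hl, h⟩ | ⟨hl, e, he, h⟩ <;> rcases hR l' with ⟨hl', h'⟩ | ⟨hl', e', he', h'⟩
    · have : q l ≠ q l' := fun h => hne (hAinj hl hl' h)
      rw [h, h']
      simpa using this
    · rw [h, h']
      simp [Fin.ext_iff, (Fin.val_ne_of_ne (hwq l' hl' l)).symm]
      omega
    · rw [h, h']
      simp [Fin.ext_iff, (Fin.val_ne_of_ne (hwq l hl l')).symm]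
      omega
    · have hww : w l ≠ w l' := fun h => hne (hinj hl hl' h)
      have hee : e ≠ e' := by
        rintro rfl
        have h₁ := hwq l hl l'
        have h₂ := hwq l' hl' l
        unfold Joins at he he'
        grind
      rw [h, h']
      simp [Fin.ext_iff, (Fin.val_ne_of_ne hww).symm,
        (Fin.val_ne_of_ne hee).symm]
      omega
  · rcases hR l with ⟨-, h⟩ | ⟨-, e, -, h⟩ <;> rw [h]
    · simp
    · exact Finset.card_le_two
  · rcases hR l with ⟨-, h⟩ | ⟨-, e, he, h⟩ <;> rw [h]
    · intro x x' hx
      simpa using hx (Fin.castAdd m (q l)) (by simp)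
    · exact he.isRecoverySet

/-- There is a graph with `k` vertices, `⌈(t - 1) k / 2⌉` edges and minimum degree at least
`t - 1`: the edges `{a, a + 1}` of a cycle, followed (if `t = 4`) by chords `{a, a + k / 2}`. -/
lemma exists_graph_min_degree (hk : 4 ≤ k) {t : ℕ} (ht : t = 3 ∨ t = 4)
    (hm : m = ((t - 1) * k + 1) / 2) :
    ∃ u v : Fin m → Fin k, ∀ a, ∃ W : Finset (Fin k), t ≤ W.card + 1 ∧
      ∀ w ∈ W, w ≠ a ∧ ∃ e, Joins u v e a w := by
  have hkm : k ≤ m ∧ m ≤ k + (k + 1) / 2 ∧ (t = 4 → m = k + (k + 1) / 2) := by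
    rcases ht with rfl | rfl <;> omega
  obtain ⟨hkm, hmk, hm₄⟩ := hkm
  refine ⟨fun e => ⟨if e.1 < k then e.1 else e.1 - k, by split_ifs <;> omega⟩,
    fun e => ⟨if e.1 + 1 < k then e.1 + 1 else if e.1 < k then 0 else e.1 - k + k / 2,
      by split_ifs <;> omega⟩, fun a => ?_⟩
  have ha := a.2
  obtain ⟨p, hp⟩ : ∃ p : Fin k, p.1 = if a.1 = 0 then k - 1 else a.1 - 1 :=
    ⟨⟨if a.1 = 0 then k - 1 else a.1 - 1, by split_ifs <;> omega⟩, rfl⟩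
  obtain ⟨s, hs⟩ : ∃ s : Fin k, s.1 = if a.1 + 1 < k then a.1 + 1 else 0 :=
    ⟨⟨if a.1 + 1 < k then a.1 + 1 else 0, by split_ifs <;> omega⟩, rfl⟩
  obtain ⟨c, hc⟩ : ∃ c : Fin k, c.1 = if a.1 < (k + 1) / 2 then a.1 + k / 2 else a.1 - k / 2 :=
    ⟨⟨if a.1 < (k + 1) / 2 then a.1 + k / 2 else a.1 - k / 2, by split_ifs <;> omega⟩, rfl⟩
  have hps : p ≠ s := by rw [Ne, Fin.ext_iff]; split_ifs at hp hs <;> omega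
  have hpc : p ≠ c := by rw [Ne, Fin.ext_iff]; split_ifs at hp hc <;> omega
  have hsc : s ≠ c := by rw [Ne, Fin.ext_iff]; split_ifs at hs hc <;> omega
  have hpa : p ≠ a := by rw [Ne, Fin.ext_iff]; split_ifs at hp <;> omega
  have hsa : s ≠ a := by rw [Ne, Fin.ext_iff]; split_ifs at hs <;> omega
  have hca : c ≠ a := by rw [Ne, Fin.ext_iff]; split_ifs at hc <;> omega
  simp only [Joins, Fin.ext_iff]
  have hpe : ∃ e : Fin m, e.1 = p.1 := ⟨⟨p.1, by omega⟩, rfl⟩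
  have hse : ∃ e : Fin m, e.1 = a.1 := ⟨⟨a.1, by omega⟩, rfl⟩
  rcases ht with rfl | rfl
  · refine ⟨{p, s}, by simp [hps], ?_⟩
    simp only [Finset.mem_insert, Finset.mem_singleton, forall_eq_or_imp, forall_eq]
    refine ⟨⟨hpa, ?_⟩, hsa, ?_⟩
    · obtain ⟨e, he⟩ := hpe
      refine ⟨e, Or.inr ?_⟩
      grind
    · obtain ⟨e, he⟩ := hse
      refine ⟨e, Or.inl ?_⟩
      grind
  · refine ⟨{p, s, c}, by simp [hps, hpc, hsc], ?_⟩
    simp only [Finset.mem_insert, Finset.mem_singleton, forall_eq_or_imp, forall_eq]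
    refine ⟨⟨hpa, ?_⟩, ⟨hsa, ?_⟩, hca, ?_⟩
    · obtain ⟨e, he⟩ := hpe
      refine ⟨e, Or.inr ?_⟩
      grind
    · obtain ⟨e, he⟩ := hse
      refine ⟨e, Or.inl ?_⟩
      grind
    · obtain ⟨e, he⟩ : ∃ e : Fin m, e.1 = k + min a.1 c.1 :=
        ⟨⟨k + min a.1 c.1, by split_ifs at hc <;> omega⟩, rfl⟩
      refine ⟨e, ?_⟩
      grind

end GraphCode

/-- Bounds on the optimal length `B(k,2,t)` of systematic linear binary batch codes with
`r = 2` and `t ∈ {3, 4}`: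
`k + t − 2 + ⌈((t−1)(k−1)+1)/t⌉ ≤ B(k,2,t) ≤ k + ⌈(t−1)k/2⌉`. -/
theorem batch_length_bounds_r_two (k t : ℕ) (hk : 4 ≤ k) (ht : t = 3 ∨ t = 4) :
    k + t - 2 + ((t - 1) * (k - 1) + 1 + (t - 1)) / t ≤
      sInf {n : ℕ | ∃ C : (Fin k → ZMod 2) →ₗ[ZMod 2] (Fin n → ZMod 2),
        IsSystematic C ∧ IsBatchCode 2 t C} ∧
    sInf {n : ℕ | ∃ C : (Fin k → ZMod 2) →ₗ[ZMod 2] (Fin n → ZMod 2),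
        IsSystematic C ∧ IsBatchCode 2 t C} ≤ k + ((t - 1) * k + 1) / 2 := by
  obtain ⟨u, v, hdeg⟩ := exists_graph_min_degree hk ht rfl
  have hmem : k + ((t - 1) * k + 1) / 2 ∈
      {n : ℕ | ∃ C : (Fin k → ZMod 2) →ₗ[ZMod 2] (Fin n → ZMod 2),
        IsSystematic C ∧ IsBatchCode 2 t C} :=
    ⟨graphCode u v, isSystematic_graphCode u v, isBatchCode_graphCode hdeg⟩
  refine ⟨le_csInf ⟨_, hmem⟩ ?_, Nat.sInf_le hmem⟩
  rintro n ⟨C, hs, hC⟩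
  rcases ht with rfl | rfl
  · have := IsPIRCode.length_lower_bound (T := 2) hs hC.isPIRCode (by omega)
    omega
  · have := IsPIRCode.length_lower_bound (T := 3) hs hC.isPIRCode (by omega)
    omega
end

section
/- Let C be a linear (n,k,r,t) batch code over a finite field F_q with minimum distance d. Then for every integer β with 1 ≤ β ≤ t, n − βr ≥ d, and k > βr − (β−1), there exists a linear code over F_q of length n − βr, dimension at least k − βr + (β−1), and minimum distance at least d; equivalently, k ≤ βr − (β−1) + k_q^opt(n − βr, d) for every such β. -/
/-- Hamming weight of a vector: the number of nonzero coordinates. -/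
noncomputable def wt {F : Type} [Field F] {ι : Type} (y : ι → F) : ℕ :=
  Nat.card {j : ι // y j ≠ 0}

/-- The linear code `C` has minimum distance (= minimum nonzero weight) exactly `d`. -/
def HasMinDist {F : Type} [Field F] {k n : ℕ}
    (C : (Fin k → F) →ₗ[F] (Fin n → F)) (d : ℕ) : Prop :=
  (∀ x : Fin k → F, x ≠ 0 → d ≤ wt (C x)) ∧ ∃ x : Fin k → F, x ≠ 0 ∧ wt (C x) = d

/-- `kopt F n d` is the largest dimension of a linear code of length `n` over `F` whose
minimum distance is at least `d` (Cadambe–Mazumdar's `k_q^opt(n,d)` for `q = |F|`). -/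
noncomputable def kopt (F : Type) [Field F] (n d : ℕ) : ℕ :=
  sSup {k : ℕ | ∃ C : (Fin k → F) →ₗ[F] (Fin n → F),
    Function.Injective C ∧ ∀ x : Fin k → F, x ≠ 0 → d ≤ wt (C x)}

open Module in
/-- If a nonzero vector lies in the span of each of `s.card` subfamilies, then the union of these
subfamilies spans a space of dimension at most the total size minus `s.card - 1`. -/
theorem finrank_span_biUnion_add_card_le {F V ι κ : Type*} [Field F] [AddCommGroup V] [Module F V]
    [FiniteDimensional F V] [DecidableEq ι] (f : ι → V) {e : V} (he : e ≠ 0) (s : Finset κ)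
    (R : κ → Finset ι) (hR : ∀ l ∈ s, e ∈ Submodule.span F (f '' (R l))) :
    finrank F (Submodule.span F (f '' (s.biUnion R)) ⊔ Submodule.span F {e} : Submodule F V)
      + s.card ≤ ∑ l ∈ s, (R l).card + 1 := by
  classical
  induction s using Finset.induction_on with
  | empty =>
    rw [Finset.biUnion_empty, Finset.coe_empty, Set.image_empty, Submodule.span_empty, bot_sup_eq,
      finrank_span_singleton he]
    simp
  | insert a s ha ih =>
    have ih := ih fun l hl => hR l (Finset.mem_insert_of_mem hl)
    have hea := hR a (Finset.mem_insert_self a s)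
    set A := Submodule.span F (f '' (s.biUnion R)) ⊔ Submodule.span F {e}
    set B := Submodule.span F (f '' (R a))
    have hAB : Submodule.span F (f '' ((insert a s).biUnion R)) ⊔ Submodule.span F {e} = A ⊔ B := by
      rw [Finset.biUnion_insert, Finset.coe_union, Set.image_union, Submodule.span_union,
        sup_assoc, sup_comm]
    have hB : finrank F B ≤ (R a).card := by
      have := finrank_span_finset_le_card (R := F) ((R a).image f)
      rw [Finset.coe_image] at this
      exact this.trans Finset.card_image_le
    have hinf : 1 ≤ finrank F (A ⊓ B : Submodule F V) := by
      rw [← finrank_span_singleton (K := F) he]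
      apply Submodule.finrank_mono
      rw [Submodule.span_singleton_le_iff_mem]
      exact ⟨Submodule.mem_sup_right (Submodule.mem_span_singleton_self e), hea⟩
    have := Submodule.finrank_sup_add_finrank_inf_eq A B
    rw [hAB, Finset.card_insert_of_notMem ha, Finset.sum_insert ha]
    omega

open Module in
/-- Enlarging a finite family increases the dimension of its span by at most the number of
added vectors. -/
theorem finrank_span_image_add_card_le {F V ι : Type*} [Field F] [AddCommGroup V] [Module F V]
    [FiniteDimensional F V] (f : ι → V) {T S : Finset ι} (hTS : T ⊆ S) :
    finrank F (Submodule.span F (f '' S)) + T.card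
      ≤ finrank F (Submodule.span F (f '' T)) + S.card := by
  classical
  have h1 := finrank_span_finset_le_card (R := F) ((S \ T).image f)
  have h2 : ((S \ T).image f).card ≤ (S \ T).card := Finset.card_image_le
  have h3 := Submodule.finrank_add_le_finrank_add_finrank
    (Submodule.span F (f '' T)) (Submodule.span F (f '' (S \ T : Finset ι)))
  rw [← Submodule.span_union, ← Set.image_union, ← Finset.coe_union,
    Finset.union_sdiff_of_subset hTS] at h3
  rw [Set.finrank, Finset.coe_image] at h1
  have h4 := Finset.card_sdiff_add_card_eq_card hTS
  omega

/-- The functional reading off the code coordinate `j`. -/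
def coordFunctional {F : Type} [Field F] {k : ℕ} {ι : Type}
    (C : (Fin k → F) →ₗ[F] (ι → F)) (j : ι) : Module.Dual F (Fin k → F) :=
  LinearMap.proj j ∘ₗ C

theorem IsRecoverySet.proj_mem_span {F : Type} [Field F] {k : ℕ} {ι : Type}
    {C : (Fin k → F) →ₗ[F] (ι → F)} {i : Fin k} {R : Finset ι} (h : IsRecoverySet C i R) :
    (LinearMap.proj i : Module.Dual F (Fin k → F)) ∈
      Submodule.span F (coordFunctional C '' R) := by
  have := mem_span_of_iInf_ker_le_ker (L := fun j : R => coordFunctional C j)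
    (K := (LinearMap.proj i : Module.Dual F (Fin k → F))) (by
      intro x hx
      simp only [Submodule.mem_iInf, LinearMap.mem_ker] at hx
      have := h x 0 fun j hj => by simpa [coordFunctional] using hx ⟨j, hj⟩
      simpa [LinearMap.mem_ker] using this)
  rwa [Set.image_eq_range]

/-- In a batch code, some `β * r` code coordinates have rank at most `β * r - (β - 1)`. -/
theorem IsBatchCode.exists_finset_finrank_span_le {F : Type} [Field F] {n k r t : ℕ}
    {C : (Fin k → F) →ₗ[F] (Fin n → F)} (hC : IsBatchCode r t C) (hk : 0 < k) {β : ℕ}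
    (hβ : β ≤ t) (hn : β * r ≤ n) :
    ∃ S : Finset (Fin n), S.card = β * r ∧
      Module.finrank F (Submodule.span F (coordFunctional C '' S)) + β ≤ β * r + 1 := by
  obtain ⟨R, hdisj, hcard, hrec⟩ := hC.2 fun _ => ⟨0, hk⟩
  let s : Finset (Fin t) := Finset.univ.map (Fin.castLEEmb hβ)
  have hs : s.card = β := by simp [s]
  have hT : (s.biUnion R).card = ∑ l ∈ s, (R l).card :=
    Finset.card_biUnion fun l₁ _ l₂ _ h => hdisj l₁ l₂ h
  have hTle : (s.biUnion R).card ≤ β * r := by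
    rw [hT, ← hs, ← smul_eq_mul]
    exact Finset.sum_le_card_nsmul _ _ _ fun l _ => hcard l
  obtain ⟨S, hTS, hS⟩ := Finset.exists_superset_card_eq hTle (by simpa using hn)
  refine ⟨S, hS, ?_⟩
  have he : (LinearMap.proj ⟨0, hk⟩ : Module.Dual F (Fin k → F)) ≠ 0 := fun h => by
    simpa using LinearMap.congr_fun h fun _ => 1
  have h1 := finrank_span_biUnion_add_card_le (coordFunctional C) he s R
    fun l _ => (hrec l).proj_mem_span
  have h2 := Submodule.finrank_mono (R := F)
    (le_sup_left : Submodule.span F (coordFunctional C '' (s.biUnion R)) ≤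
      _ ⊔ Submodule.span F {(LinearMap.proj ⟨0, hk⟩ : Module.Dual F (Fin k → F))})
  have h3 := finrank_span_image_add_card_le (F := F) (coordFunctional C) hTS
  omega

/-- The dimension of a linear code with minimum distance at least `d` is at most `kopt`. -/
theorem le_kopt {F : Type} [Field F] {k n d : ℕ} (C : (Fin k → F) →ₗ[F] (Fin n → F))
    (hC : Function.Injective C) (hd : ∀ x : Fin k → F, x ≠ 0 → d ≤ wt (C x)) :
    k ≤ kopt F n d := by
  refine le_csSup ⟨n, ?_⟩ ⟨C, hC, hd⟩
  rintro m ⟨D, hD, -⟩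
  simpa using LinearMap.finrank_le_finrank_of_injective hD

/-- Shortening a code at a set `S` of coordinates: the codewords vanishing on `S`, with the
coordinates in `S` deleted, form a code whose minimum distance is no smaller. -/
theorem exists_shortened_code {F : Type} [Field F] {n k d : ℕ}
    (C : (Fin k → F) →ₗ[F] (Fin n → F)) (hd : ∀ x : Fin k → F, x ≠ 0 → d ≤ wt (C x))
    (hpos : 0 < d) {m : ℕ} (S : Finset (Fin n)) (hS : S.card = m) :
    ∃ k' : ℕ, Module.finrank F (Submodule.span F (coordFunctional C '' S)) + k' = k ∧
      ∃ C' : (Fin k' → F) →ₗ[F] (Fin (n - m) → F),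
        Function.Injective C' ∧ ∀ x : Fin k' → F, x ≠ 0 → d ≤ wt (C' x) := by
  set K := (Submodule.span F (coordFunctional C '' S)).dualCoannihilator
  have hK : ∀ x ∈ K, ∀ j ∈ S, C x j = 0 := fun x hx j hj =>
    (Submodule.mem_dualCoannihilator x).1 hx (coordFunctional C j)
      (Submodule.subset_span ⟨j, hj, rfl⟩)
  let g := (Module.finBasis F K).equivFun.symm
  let e : Fin (n - m) ≃ {j // j ∉ S} := (Fintype.equivFinOfCardEq (by simp [hS])).symm
  let C' := LinearMap.funLeft F F (fun a => (e a : Fin n)) ∘ₗ C ∘ₗ K.subtype ∘ₗ g.toLinearMap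
  have hdist : ∀ x, x ≠ 0 → d ≤ wt (C' x) := by
    intro x hx
    have hgx : (g x : Fin k → F) ≠ 0 := by
      simpa using (map_ne_zero_iff g g.injective).2 hx
    refine (hd _ hgx).trans (Nat.card_le_card_of_injective
      (fun j => ⟨e.symm ⟨j, fun hj => j.2 (hK _ (g x).2 _ hj)⟩, ?_⟩) ?_)
    · simpa [C', LinearMap.funLeft_apply] using j.2
    · intro a b hab
      simpa [Subtype.ext_iff] using hab
  refine ⟨Module.finrank F K, ?_, C', ?_, hdist⟩
  · rw [Subspace.finrank_add_finrank_dualCoannihilator_eq, Module.finrank_fin_fun]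
  · rw [← LinearMap.ker_eq_bot, LinearMap.ker_eq_bot']
    intro x hx
    by_contra hne
    have := hdist x hne
    rw [hx] at this
    simp [wt] at this
    omega

/-- Recursive Cadambe–Mazumdar-type bound for batch codes: if `C` is a linear
`(n,k,r,t)` batch code over a finite field `F` with minimum distance `d`, then for every
`β` with `1 ≤ β ≤ t`, `n − βr ≥ d` and `k > βr − (β−1)`, there is a linear code over `F`
of length `n − βr`, dimension at least `k − (βr − (β−1))` and minimum distance at least
`d`; equivalently, `k ≤ βr − (β−1) + k_q^opt(n − βr, d)` for every such `β`. -/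
theorem batch_dimension_bound_recursive {F : Type} [Field F] [Fintype F] {n k r t d : ℕ}
    (C : (Fin k → F) →ₗ[F] (Fin n → F)) (hC : IsBatchCode r t C)
    (hd : HasMinDist C d) :
    ∀ β : ℕ, 1 ≤ β → β ≤ t → β * r + d ≤ n → β * r - (β - 1) < k →
      (∃ k' : ℕ, k - (β * r - (β - 1)) ≤ k' ∧
        ∃ C' : (Fin k' → F) →ₗ[F] (Fin (n - β * r) → F),
          Function.Injective C' ∧ ∀ x : Fin k' → F, x ≠ 0 → d ≤ wt (C' x)) ∧
      k ≤ β * r - (β - 1) + kopt F (n - β * r) d := by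
  intro β hβ1 hβt hn hk
  obtain ⟨x, hx, hxd⟩ := hd.2
  have hCx : C x ≠ 0 := (map_ne_zero_iff C hC.1).2 hx
  obtain ⟨j, hj⟩ := Function.ne_iff.1 hCx
  have hpos : 0 < d := by
    rw [← hxd, wt, Nat.card_pos_iff]
    exact ⟨⟨⟨j, hj⟩⟩, inferInstance⟩
  obtain ⟨S, hS, hrank⟩ := hC.exists_finset_finrank_span_le (by omega) hβt (by omega)
  obtain ⟨k', hk', C', hinj, hdist⟩ := exists_shortened_code C hd.1 hpos S hS
  have hle := le_kopt C' hinj hdist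
  exact ⟨⟨k', by omega, C', hinj, hdist⟩, by omega⟩
end
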